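/- Let G be an abelian group with neutral element e, and let g,h,g',h' ∈ G with h² = e ≠ h and (h')² = e ≠ h'. The gradings Γ²(G;g,h) and Γ²(G;g',h') on K₃ × K₃ are isomorphic if and only if h' = h and g' ∈ {g, gh, g⁻¹, g⁻¹h}. -/

import Mathlib

open scoped TensorProduct
noncomputable section
namespace Kac

/-! ### Superalgebra isomorphisms and automorphisms -/

@[ext]
structure SuperIso (S A B : Type) [CommRing S]
    [AddCommGroup A] [Module S A] [Mul A]
    [AddCommGroup B] [Module S B] [Mul B]
    (evA odA : Submodule S A) (evB odB : Submodule S B) : Type where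
  e : A ≃ₗ[S] B
  map_mul' : ∀ x y : A, e (x * y) = e x * e y
  map_even : evA.map e.toLinearMap = evB
  map_odd : odA.map e.toLinearMap = odB

abbrev SuperAut (S A : Type) [CommRing S] [AddCommGroup A] [Module S A] [Mul A]
    (ev od : Submodule S A) := SuperIso S A A ev od ev od

namespace SuperAut

variable {S A : Type} [CommRing S] [AddCommGroup A] [Module S A] [Mul A]
variable {ev od : Submodule S A}

private lemma map_symm {f : A ≃ₗ[S] A} {p : Submodule S A}
    (h : p.map f.toLinearMap = p) : p.map f.symm.toLinearMap = p := by
  have h2 : f.symm.toLinearMap.comp f.toLinearMap = LinearMap.id := by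
    ext x; simp
  calc p.map f.symm.toLinearMap
      = (p.map f.toLinearMap).map f.symm.toLinearMap := by rw [h]
    _ = p.map (f.symm.toLinearMap.comp f.toLinearMap) := by
        rw [Submodule.map_comp]
    _ = p := by rw [h2, Submodule.map_id]

instance : Group (SuperAut S A ev od) where
  one := ⟨LinearEquiv.refl S A, fun _ _ => rfl, Submodule.map_id _, Submodule.map_id _⟩
  mul f g := ⟨g.e.trans f.e,
    fun x y => by simp [LinearEquiv.trans_apply, g.map_mul', f.map_mul'],
    by rw [LinearEquiv.coe_trans, Submodule.map_comp, g.map_even, f.map_even],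
    by rw [LinearEquiv.coe_trans, Submodule.map_comp, g.map_odd, f.map_odd]⟩
  inv f := ⟨f.e.symm,
    fun x y => f.e.injective <| by simp [f.map_mul'],
    map_symm f.map_even, map_symm f.map_odd⟩
  mul_assoc f g h := by apply SuperIso.ext; apply LinearEquiv.ext; intro x; rfl
  one_mul f := by apply SuperIso.ext; apply LinearEquiv.ext; intro x; rfl
  mul_one f := by apply SuperIso.ext; apply LinearEquiv.ext; intro x; rfl
  inv_mul_cancel f := by
    apply SuperIso.ext; apply LinearEquiv.ext; intro x
    exact f.e.symm_apply_apply x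

end SuperAut

/-- The predicate that a pair of submodules `ev`, `od` makes a non-unital
(possibly non-associative) algebra `B` into a superalgebra. -/
def IsSuperalgebra (S B : Type) [CommRing S] [NonUnitalNonAssocRing B] [Module S B]
    (ev od : Submodule S B) : Prop :=
  ev ⊔ od = ⊤ ∧ ev ⊓ od = ⊥ ∧
  (∀ x ∈ ev, ∀ y ∈ ev, x * y ∈ ev) ∧ (∀ x ∈ ev, ∀ y ∈ od, x * y ∈ od) ∧
  (∀ x ∈ od, ∀ y ∈ ev, x * y ∈ od) ∧ (∀ x ∈ od, ∀ y ∈ od, x * y ∈ ev)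

/-! ### Submodules given by vanishing of coordinates -/

def stdSub (S R : Type) [Semiring S] [AddCommGroup R] [Module S R] (n : ℕ)
    (s : Set (Fin n)) : Submodule S (Fin n → R) where
  carrier := {x | ∀ i, i ∉ s → x i = 0}
  add_mem' := fun {a b} ha hb i hi => by
    simp [Pi.add_apply, ha i hi, hb i hi]
  zero_mem' := fun i _ => rfl
  smul_mem' := fun c x hx i hi => by
    simp [Pi.smul_apply, hx i hi]

/-! ### Gradings by abelian groups -/

section Gradings

variable {G H S A : Type} [CommGroup G] [CommGroup H] [CommRing S]
  [AddCommGroup A] [Module S A] [Mul A]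

/-- `comp` is a `G`-grading of the superalgebra `(A, ev, od)`. -/
def IsSuperGrading (ev od : Submodule S A) (comp : G → Submodule S A) : Prop :=
  (letI := Classical.decEq G; DirectSum.IsInternal comp) ∧
  (∀ (g h : G) (x y : A), x ∈ comp g → y ∈ comp h → x * y ∈ comp (g * h)) ∧
  (∀ g, comp g = (comp g ⊓ ev) ⊔ (comp g ⊓ od))

/-- The grading with homogeneous elements `w i` of degrees `d i`. -/
def gradingOf (S : Type) {A G : Type} [CommRing S] [AddCommGroup A] [Module S A]
    [CommGroup G] {n : ℕ} (w : Fin n → A) (d : Fin n → G) : G → Submodule S A :=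
  fun g => Submodule.span S (w '' {i | d i = g})

/-- Isomorphism of two `G`-gradings on a superalgebra. -/
def GradIso (ev od : Submodule S A) (comp comp' : G → Submodule S A) : Prop :=
  ∃ φ : SuperAut S A ev od, ∀ g, (comp g).map φ.e.toLinearMap = comp' g

/-- `Δ` refines `Γ`. -/
def Refines (Δ : H → Submodule S A) (Γ : G → Submodule S A) : Prop :=
  ∀ h, Δ h ≠ ⊥ → ∃ g, Δ h ≤ Γ g

/-- Equivalence of a `G`-grading and an `H`-grading on a superalgebra. -/
def GradEquiv (ev od : Submodule S A) (Γ : G → Submodule S A)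
    (Δ : H → Submodule S A) : Prop :=
  ∃ φ : SuperAut S A ev od, ∃ α : {g : G // Γ g ≠ ⊥} → {h : H // Δ h ≠ ⊥},
    Function.Bijective α ∧
    ∀ g : {g : G // Γ g ≠ ⊥}, (Γ g.1).map φ.e.toLinearMap = Δ (α g).1

/-- A grading is fine if any grading refining it has the same nonzero
homogeneous components. -/
def IsFine (ev od : Submodule S A) (Γ : G → Submodule S A) : Prop :=
  ∀ (H : Type) (_ : CommGroup H) (Δ : H → Submodule S A),
    IsSuperGrading ev od Δ → Refines Δ Γ →
      {p : Submodule S A | p ≠ ⊥ ∧ ∃ h, Δ h = p} =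
      {p : Submodule S A | p ≠ ⊥ ∧ ∃ g, Γ g = p}

end Gradings

/-! ### SL₂ and the semidirect product with C₂ -/

abbrev SL2 (R : Type) [CommRing R] := Matrix.SpecialLinearGroup (Fin 2) R

def swapAut (M : Type) [Monoid M] : MulAut (M × M) := MulEquiv.prodComm

lemma swapAut_sq (M : Type) [Monoid M] : swapAut M * swapAut M = 1 :=
  MulEquiv.ext fun _ => rfl

/-- The action of `C₂ = Multiplicative (ZMod 2)` on `M × M` by swapping the factors. -/
def swapHom (M : Type) [Group M] : Multiplicative (ZMod 2) →* MulAut (M × M) :=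
  MonoidHom.mk' (fun c => if c.toAdd = 0 then 1 else swapAut M) (by
    intro a b
    have key : ∀ c : Multiplicative (ZMod 2),
        c = Multiplicative.ofAdd 0 ∨ c = Multiplicative.ofAdd 1 := by decide
    rcases key a with rfl | rfl <;> rcases key b with rfl | rfl <;>
      simp [← ofAdd_add, swapAut_sq] <;> exact fun h => absurd (by decide) h)

end Kac
/-! ### The (base-changed) Kaplansky superalgebra `K₃ ⊗ R` -/

namespace Kac

section Algebras

variable (F : Type) [Field F] (R : Type) [CommRing R] [Algebra F R]

/-- Coordinates: `0 ↦ a`, `1 ↦ u`, `2 ↦ v`. -/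
def K3A (F : Type) [Field F] (R : Type) [CommRing R] [Algebra F R] : Type := Fin 3 → R

instance : AddCommGroup (K3A F R) := Pi.addCommGroup
instance (S : Type) [Semiring S] [Module S R] : Module S (K3A F R) := Pi.module _ _ _

namespace K3A
variable {F R}

def mulFun (x y : K3A F R) : K3A F R := fun i =>
  match i with
  | ⟨0, _⟩ => x 0 * y 0 + (x 1 * y 2 - x 2 * y 1)
  | ⟨1, _⟩ => algebraMap F R 2⁻¹ * (x 0 * y 1 + y 0 * x 1)
  | ⟨2, _⟩ => algebraMap F R 2⁻¹ * (x 0 * y 2 + y 0 * x 2)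

instance : Mul (K3A F R) := ⟨mulFun⟩

lemma mul_def (x y : K3A F R) : x * y = mulFun x y := rfl

@[simp] lemma add_apply (x y : K3A F R) (i : Fin 3) : (x + y) i = x i + y i := rfl
@[simp] lemma sub_apply (x y : K3A F R) (i : Fin 3) : (x - y) i = x i - y i := rfl
@[simp] lemma neg_apply (x : K3A F R) (i : Fin 3) : (-x) i = -(x i) := rfl
@[simp] lemma zero_apply (i : Fin 3) : (0 : K3A F R) i = 0 := rfl
@[simp] lemma smul_apply (S : Type) [Semiring S] [Module S R] (c : S) (x : K3A F R) (i : Fin 3) :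
    (c • x) i = c • (x i) := rfl

variable (F R)

/-- The even part `R·a`. -/
def even (S : Type) [Semiring S] [Module S R] : Submodule S (K3A F R) := stdSub S R 3 {0}
/-- The odd part `W ⊗ R`. -/
def odd (S : Type) [Semiring S] [Module S R] : Submodule S (K3A F R) := stdSub S R 3 {1, 2}

/-- The element `a`. -/
def aE : K3A F R := ![1, 0, 0]
/-- The element of `W ⊗ R` with coordinates `w` in the symplectic basis `{u, v}`. -/
def wE (w : Fin 2 → R) : K3A F R := ![0, w 0, w 1]

end K3A

/-- `J(W) ⊗ R`; coordinates: `0 ↦ 1`, `1 ↦ u`, `2 ↦ v`. -/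
def JW1A (R : Type) [CommRing R] : Type := Fin 3 → R

instance : AddCommGroup (JW1A R) := Pi.addCommGroup
instance (S : Type) [Semiring S] [Module S R] : Module S (JW1A R) := Pi.module _ _ _

namespace JW1A
variable {R}

def mulFun (x y : JW1A R) : JW1A R := fun i =>
  match i with
  | ⟨0, _⟩ => x 0 * y 0 + (x 1 * y 2 - x 2 * y 1)
  | ⟨1, _⟩ => x 0 * y 1 + y 0 * x 1
  | ⟨2, _⟩ => x 0 * y 2 + y 0 * x 2

instance : Mul (JW1A R) := ⟨mulFun⟩

lemma mul_def (x y : JW1A R) : x * y = mulFun x y := rfl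

@[simp] lemma add_apply (x y : JW1A R) (i : Fin 3) : (x + y) i = x i + y i := rfl
@[simp] lemma sub_apply (x y : JW1A R) (i : Fin 3) : (x - y) i = x i - y i := rfl
@[simp] lemma neg_apply (x : JW1A R) (i : Fin 3) : (-x) i = -(x i) := rfl
@[simp] lemma zero_apply (i : Fin 3) : (0 : JW1A R) i = 0 := rfl
@[simp] lemma smul_apply (S : Type) [Semiring S] [Module S R] (c : S) (x : JW1A R) (i : Fin 3) :
    (c • x) i = c • (x i) := rfl

variable (R)

def even (S : Type) [Semiring S] [Module S R] : Submodule S (JW1A R) := stdSub S R 3 {0}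
def odd (S : Type) [Semiring S] [Module S R] : Submodule S (JW1A R) := stdSub S R 3 {1, 2}

def oneE : JW1A R := ![1, 0, 0]
def wE (w : Fin 2 → R) : JW1A R := ![0, w 0, w 1]

end JW1A

/-- `(K₃ × K₃) ⊗ R`; coordinates `0,1,2` for the first copy (`a,u,v`),
`3,4,5` for the second copy. -/
def K33A (F : Type) [Field F] (R : Type) [CommRing R] [Algebra F R] : Type := Fin 6 → R

instance : AddCommGroup (K33A F R) := Pi.addCommGroup
instance (S : Type) [Semiring S] [Module S R] : Module S (K33A F R) := Pi.module _ _ _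

namespace K33A
variable {F R}

def mulFun (x y : K33A F R) : K33A F R := fun i =>
  match i with
  | ⟨0, _⟩ => x 0 * y 0 + (x 1 * y 2 - x 2 * y 1)
  | ⟨1, _⟩ => algebraMap F R 2⁻¹ * (x 0 * y 1 + y 0 * x 1)
  | ⟨2, _⟩ => algebraMap F R 2⁻¹ * (x 0 * y 2 + y 0 * x 2)
  | ⟨3, _⟩ => x 3 * y 3 + (x 4 * y 5 - x 5 * y 4)
  | ⟨4, _⟩ => algebraMap F R 2⁻¹ * (x 3 * y 4 + y 3 * x 4)
  | ⟨5, _⟩ => algebraMap F R 2⁻¹ * (x 3 * y 5 + y 3 * x 5)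

instance : Mul (K33A F R) := ⟨mulFun⟩

lemma mul_def (x y : K33A F R) : x * y = mulFun x y := rfl

@[simp] lemma add_apply (x y : K33A F R) (i : Fin 6) : (x + y) i = x i + y i := rfl
@[simp] lemma sub_apply (x y : K33A F R) (i : Fin 6) : (x - y) i = x i - y i := rfl
@[simp] lemma neg_apply (x : K33A F R) (i : Fin 6) : (-x) i = -(x i) := rfl
@[simp] lemma zero_apply (i : Fin 6) : (0 : K33A F R) i = 0 := rfl
@[simp] lemma smul_apply (S : Type) [Semiring S] [Module S R] (c : S) (x : K33A F R) (i : Fin 6) :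
    (c • x) i = c • (x i) := rfl

variable (F R)

def even (S : Type) [Semiring S] [Module S R] : Submodule S (K33A F R) := stdSub S R 6 {0, 3}
def odd (S : Type) [Semiring S] [Module S R] : Submodule S (K33A F R) := stdSub S R 6 {1, 2, 4, 5}

/-- The element `(a, 0)`. -/
def aLeft : K33A F R := ![1, 0, 0, 0, 0, 0]
/-- The element `(0, a)`. -/
def aRight : K33A F R := ![0, 0, 0, 1, 0, 0]
/-- The element `(v, w)` of the odd part, `v, w ∈ W ⊗ R`. -/
def oddE (w w' : Fin 2 → R) : K33A F R := ![0, w 0, w 1, 0, w' 0, w' 1]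
/-- The exchange automorphism `(x, y) ↦ (y, x)`. -/
def swapFun (x : K33A F R) : K33A F R := fun i =>
  match i with
  | ⟨0, _⟩ => x 3
  | ⟨1, _⟩ => x 4
  | ⟨2, _⟩ => x 5
  | ⟨3, _⟩ => x 0
  | ⟨4, _⟩ => x 1
  | ⟨5, _⟩ => x 2

end K33A

/-- `(J(W) × J(W)) ⊗ R`. -/
def JW2A (R : Type) [CommRing R] : Type := Fin 6 → R

instance : AddCommGroup (JW2A R) := Pi.addCommGroup
instance (S : Type) [Semiring S] [Module S R] : Module S (JW2A R) := Pi.module _ _ _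

namespace JW2A
variable {R}

def mulFun (x y : JW2A R) : JW2A R := fun i =>
  match i with
  | ⟨0, _⟩ => x 0 * y 0 + (x 1 * y 2 - x 2 * y 1)
  | ⟨1, _⟩ => x 0 * y 1 + y 0 * x 1
  | ⟨2, _⟩ => x 0 * y 2 + y 0 * x 2
  | ⟨3, _⟩ => x 3 * y 3 + (x 4 * y 5 - x 5 * y 4)
  | ⟨4, _⟩ => x 3 * y 4 + y 3 * x 4
  | ⟨5, _⟩ => x 3 * y 5 + y 3 * x 5

instance : Mul (JW2A R) := ⟨mulFun⟩

lemma mul_def (x y : JW2A R) : x * y = mulFun x y := rfl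

@[simp] lemma add_apply (x y : JW2A R) (i : Fin 6) : (x + y) i = x i + y i := rfl
@[simp] lemma sub_apply (x y : JW2A R) (i : Fin 6) : (x - y) i = x i - y i := rfl
@[simp] lemma neg_apply (x : JW2A R) (i : Fin 6) : (-x) i = -(x i) := rfl
@[simp] lemma zero_apply (i : Fin 6) : (0 : JW2A R) i = 0 := rfl
@[simp] lemma smul_apply (S : Type) [Semiring S] [Module S R] (c : S) (x : JW2A R) (i : Fin 6) :
    (c • x) i = c • (x i) := rfl

variable (R)

def even (S : Type) [Semiring S] [Module S R] : Submodule S (JW2A R) := stdSub S R 6 {0, 3}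
def odd (S : Type) [Semiring S] [Module S R] : Submodule S (JW2A R) := stdSub S R 6 {1, 2, 4, 5}

/-- The element `(1, 0)`. -/
def oneLeft : JW2A R := ![1, 0, 0, 0, 0, 0]
/-- The element `(0, 1)`. -/
def oneRight : JW2A R := ![0, 0, 0, 1, 0, 0]
def oddE (w w' : Fin 2 → R) : JW2A R := ![0, w 0, w 1, 0, w' 0, w' 1]
def swapFun (x : JW2A R) : JW2A R := fun i =>
  match i with
  | ⟨0, _⟩ => x 3
  | ⟨1, _⟩ => x 4
  | ⟨2, _⟩ => x 5
  | ⟨3, _⟩ => x 0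
  | ⟨4, _⟩ => x 1
  | ⟨5, _⟩ => x 2

end JW2A

/-- Kac's superalgebra `K₁₀ ⊗ R`.  CoordinatesL `0 ↦ 1`, `1 ↦ a⊗a`,
`2 ↦ u⊗u`, `3 ↦ u⊗v`, `4 ↦ v⊗u`, `5 ↦ v⊗v`, `6 ↦ u⊗a`, `7 ↦ v⊗a`,
`8 ↦ a⊗u`, `9 ↦ a⊗v`. -/
def K10A (F : Type) [Field F] (R : Type) [CommRing R] [Algebra F R] : Type := Fin 10 → R

instance : AddCommGroup (K10A F R) := Pi.addCommGroup
instance (S : Type) [Semiring S] [Module S R] : Module S (K10A F R) := Pi.module _ _ _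

namespace K10A
variable {F R}

def mulFun (x y : K10A F R) : K10A F R := fun i =>
  match i with
  | ⟨0, _⟩ => x 0 * y 0 - algebraMap F R (3/16) * (x 1 * y 1)
      + algebraMap F R (3/4) * (x 2 * y 5 + x 5 * y 2 - x 3 * y 4 - x 4 * y 3)
      - algebraMap F R (3/8) * (x 6 * y 7 - x 7 * y 6 + x 8 * y 9 - x 9 * y 8)
  | ⟨1, _⟩ => x 0 * y 1 + x 1 * y 0 + x 1 * y 1
      - (x 2 * y 5 + x 5 * y 2 - x 3 * y 4 - x 4 * y 3)
      + (x 6 * y 7 - x 7 * y 6) + (x 8 * y 9 - x 9 * y 8)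
  | ⟨2, _⟩ => x 0 * y 2 + x 2 * y 0 + algebraMap F R 4⁻¹ * (x 1 * y 2 + x 2 * y 1)
      + algebraMap F R 4⁻¹ * (x 6 * y 8 - x 8 * y 6)
  | ⟨3, _⟩ => x 0 * y 3 + x 3 * y 0 + algebraMap F R 4⁻¹ * (x 1 * y 3 + x 3 * y 1)
      + algebraMap F R 4⁻¹ * (x 6 * y 9 - x 9 * y 6)
  | ⟨4, _⟩ => x 0 * y 4 + x 4 * y 0 + algebraMap F R 4⁻¹ * (x 1 * y 4 + x 4 * y 1)
      + algebraMap F R 4⁻¹ * (x 7 * y 8 - x 8 * y 7)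
  | ⟨5, _⟩ => x 0 * y 5 + x 5 * y 0 + algebraMap F R 4⁻¹ * (x 1 * y 5 + x 5 * y 1)
      + algebraMap F R 4⁻¹ * (x 7 * y 9 - x 9 * y 7)
  | ⟨6, _⟩ => x 0 * y 6 + x 6 * y 0 + algebraMap F R 2⁻¹ * (x 1 * y 6 + x 6 * y 1)
      + algebraMap F R 2⁻¹ * (x 2 * y 9 + x 9 * y 2) - algebraMap F R 2⁻¹ * (x 3 * y 8 + x 8 * y 3)
  | ⟨7, _⟩ => x 0 * y 7 + x 7 * y 0 + algebraMap F R 2⁻¹ * (x 1 * y 7 + x 7 * y 1)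
      + algebraMap F R 2⁻¹ * (x 4 * y 9 + x 9 * y 4) - algebraMap F R 2⁻¹ * (x 5 * y 8 + x 8 * y 5)
  | ⟨8, _⟩ => x 0 * y 8 + x 8 * y 0 + algebraMap F R 2⁻¹ * (x 1 * y 8 + x 8 * y 1)
      - algebraMap F R 2⁻¹ * (x 2 * y 7 + x 7 * y 2) + algebraMap F R 2⁻¹ * (x 4 * y 6 + x 6 * y 4)
  | ⟨9, _⟩ => x 0 * y 9 + x 9 * y 0 + algebraMap F R 2⁻¹ * (x 1 * y 9 + x 9 * y 1)
      - algebraMap F R 2⁻¹ * (x 3 * y 7 + x 7 * y 3) + algebraMap F R 2⁻¹ * (x 5 * y 6 + x 6 * y 5)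

instance : Mul (K10A F R) := ⟨mulFun⟩

lemma mul_def (x y : K10A F R) : x * y = mulFun x y := rfl

@[simp] lemma add_apply (x y : K10A F R) (i : Fin 10) : (x + y) i = x i + y i := rfl
@[simp] lemma sub_apply (x y : K10A F R) (i : Fin 10) : (x - y) i = x i - y i := rfl
@[simp] lemma neg_apply (x : K10A F R) (i : Fin 10) : (-x) i = -(x i) := rfl
@[simp] lemma zero_apply (i : Fin 10) : (0 : K10A F R) i = 0 := rfl
@[simp] lemma smul_apply (S : Type) [Semiring S] [Module S R] (c : S) (x : K10A F R) (i : Fin 10) :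
    (c • x) i = c • (x i) := rfl

variable (F R)

def even (S : Type) [Semiring S] [Module S R] : Submodule S (K10A F R) :=
  stdSub S R 10 {0, 1, 2, 3, 4, 5}
def odd (S : Type) [Semiring S] [Module S R] : Submodule S (K10A F R) :=
  stdSub S R 10 {6, 7, 8, 9}

/-- The unity `1`. -/
def oneE : K10A F R := ![1, 0, 0, 0, 0, 0, 0, 0, 0, 0]
/-- The element `a ⊗ a`. -/
def aaE : K10A F R := ![0, 1, 0, 0, 0, 0, 0, 0, 0, 0]
/-- The element `v ⊗ w ∈ W ⊗ W`. -/
def wwE (w w' : Fin 2 → R) : K10A F R :=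
  ![0, 0, w 0 * w' 0, w 0 * w' 1, w 1 * w' 0, w 1 * w' 1, 0, 0, 0, 0]
/-- The element `w ⊗ a`, `w ∈ W ⊗ R`. -/
def waE (w : Fin 2 → R) : K10A F R := ![0, 0, 0, 0, 0, 0, w 0, w 1, 0, 0]
/-- The element `a ⊗ w`, `w ∈ W ⊗ R`. -/
def awE (w : Fin 2 → R) : K10A F R := ![0, 0, 0, 0, 0, 0, 0, 0, w 0, w 1]
/-- The exchange automorphism `τ`, `τ(x ⊗ y) = (-1)^{|x||y|} y ⊗ x`. -/
def tauFun (x : K10A F R) : K10A F R := fun i =>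
  match i with
  | ⟨0, _⟩ => x 0
  | ⟨1, _⟩ => x 1
  | ⟨2, _⟩ => -x 2
  | ⟨3, _⟩ => -x 4
  | ⟨4, _⟩ => -x 3
  | ⟨5, _⟩ => -x 5
  | ⟨6, _⟩ => x 8
  | ⟨7, _⟩ => x 9
  | ⟨8, _⟩ => x 6
  | ⟨9, _⟩ => x 7

end K10A

end Algebras

end Kac

namespace Kac

section GradingDefs

variable (F : Type) [Field F] {G : Type} [CommGroup G]

/-- Standard basis of `K₃ × K₃` (`a₁, u₁, v₁, a₂, u₂, v₂`). -/
def K33A.bv (i : Fin 6) : K33A F F := Pi.single i 1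

/-- The grading `Γ¹(G; g₁, g₂)` on `K₃ × K₃`: all even elements have degree
`e`, `deg (u,0) = g₁ = deg (v,0)⁻¹`, `deg (0,u) = g₂ = deg (0,v)⁻¹`. -/
def K33A.gamma1 (g1 g2 : G) : G → Submodule F (K33A F F) :=
  gradingOf F (K33A.bv F) ![1, g1, g1⁻¹, 1, g2, g2⁻¹]

/-- The grading `Γ²(G; g, h)` on `K₃ × K₃` (`h² = e ≠ h`):
`deg (a,a) = e`, `deg (a,-a) = h`, `deg (u,u) = g = deg (v,v)⁻¹`,
`deg (u,-u) = gh = deg (v,-v)⁻¹`. -/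
def K33A.gamma2 (g h : G) : G → Submodule F (K33A F F) :=
  gradingOf F
    ![K33A.bv F 0 + K33A.bv F 3, K33A.bv F 0 - K33A.bv F 3,
      K33A.bv F 1 + K33A.bv F 4, K33A.bv F 2 + K33A.bv F 5,
      K33A.bv F 1 - K33A.bv F 4, K33A.bv F 2 - K33A.bv F 5]
    ![1, h, g, g⁻¹, g * h, g⁻¹ * h]

/-- Standard (homogeneous) basis of `K₁₀`:
`1, a⊗a, u⊗u, u⊗v, v⊗u, v⊗v, u⊗a, v⊗a, a⊗u, a⊗v`. -/
def K10A.bv (i : Fin 10) : K10A F F := Pi.single i 1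

/-- The grading `Γ¹_{K₁₀}(G; g₁, g₂)` on `K₁₀`, determined by
`deg (u⊗a) = g₁ = deg (v⊗a)⁻¹`, `deg (a⊗u) = g₂ = deg (a⊗v)⁻¹`. -/
def K10A.gamma1 (g1 g2 : G) : G → Submodule F (K10A F F) :=
  gradingOf F (K10A.bv F)
    ![1, 1, g1 * g2, g1 * g2⁻¹, g1⁻¹ * g2, g1⁻¹ * g2⁻¹, g1, g1⁻¹, g2, g2⁻¹]

/-- The grading `Γ²_{K₁₀}(G; g, h)` on `K₁₀` (`h² = e ≠ h`), determined by
`deg (u⊗a + a⊗u) = g = deg (v⊗a + a⊗v)⁻¹`,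
`deg (u⊗a - a⊗u) = gh = deg (v⊗a - a⊗v)⁻¹`. -/
def K10A.gamma2 (g h : G) : G → Submodule F (K10A F F) :=
  gradingOf F
    ![K10A.bv F 0, K10A.bv F 1, K10A.bv F 3 - K10A.bv F 4,
      K10A.bv F 3 + K10A.bv F 4, K10A.bv F 2, K10A.bv F 5,
      K10A.bv F 6 + K10A.bv F 8, K10A.bv F 7 + K10A.bv F 9,
      K10A.bv F 6 - K10A.bv F 8, K10A.bv F 7 - K10A.bv F 9]
    ![1, 1, 1, h, g * g * h, g⁻¹ * g⁻¹ * h, g, g⁻¹, g * h, g⁻¹ * h]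

end GradingDefs

end Kac

namespace Kac

section Gamma2Iso

lemma GradIso.trans {G S A : Type} [CommRing S] [AddCommGroup A]
    [Module S A] [Mul A] {ev od : Submodule S A} {Γ₁ Γ₂ Γ₃ : G → Submodule S A}
    (h₁ : GradIso ev od Γ₁ Γ₂) (h₂ : GradIso ev od Γ₂ Γ₃) :
    GradIso ev od Γ₁ Γ₃ := by
  obtain ⟨φ, hφ⟩ := h₁
  obtain ⟨ψ, hψ⟩ := h₂
  refine ⟨ψ * φ, fun g => ?_⟩
  rw [← hψ g, ← hφ g, ← Submodule.map_comp]
  rfl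

lemma GradIso.refl {G S A : Type} [CommRing S] [AddCommGroup A]
    [Module S A] [Mul A] (ev od : Submodule S A) (Γ : G → Submodule S A) :
    GradIso ev od Γ Γ :=
  ⟨1, fun g => Submodule.map_id (Γ g)⟩

namespace K33A

variable {F : Type} [Field F]

lemma ext_coord {x y : K33A F F} (h0 : x 0 = y 0) (h1 : x 1 = y 1) (h2 : x 2 = y 2)
    (h3 : x 3 = y 3) (h4 : x 4 = y 4) (h5 : x 5 = y 5) : x = y := by
  funext i
  fin_cases i <;> assumption

/-- The element with the given coordinates. -/
def ofCoord (a b c d e f : F) : K33A F F := ![a, b, c, d, e, f]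

section OfCoord

variable (a b c d e f : F)

@[simp] lemma ofCoord_zero : ofCoord a b c d e f 0 = a := rfl
@[simp] lemma ofCoord_one : ofCoord a b c d e f 1 = b := rfl
@[simp] lemma ofCoord_two : ofCoord a b c d e f 2 = c := rfl
@[simp] lemma ofCoord_three : ofCoord a b c d e f 3 = d := rfl
@[simp] lemma ofCoord_four : ofCoord a b c d e f 4 = e := rfl
@[simp] lemma ofCoord_five : ofCoord a b c d e f 5 = f := rfl

end OfCoord

lemma bv_apply (i j : Fin 6) : bv F i j = if j = i then 1 else 0 :=
  Pi.single_apply i (1 : F) j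

lemma mem_even_iff {x : K33A F F} :
    x ∈ even F F F ↔ x 1 = 0 ∧ x 2 = 0 ∧ x 4 = 0 ∧ x 5 = 0 := by
  change (∀ i : Fin 6, i ∉ ({0, 3} : Set (Fin 6)) → x i = 0) ↔ _
  simp [Fin.forall_fin_succ]

lemma mem_odd_iff {x : K33A F F} : x ∈ odd F F F ↔ x 0 = 0 ∧ x 3 = 0 := by
  change (∀ i : Fin 6, i ∉ ({1, 2, 4, 5} : Set (Fin 6)) → x i = 0) ↔ _
  simp [Fin.forall_fin_succ]

variable {G : Type} [CommGroup G]

lemma mem_gamma2_iff (hchar : (2 : F) ≠ 0) {g h k : G} {x : K33A F F} :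
    x ∈ gamma2 F g h k ↔
      (k = 1 ∨ x 0 + x 3 = 0) ∧ (k = h ∨ x 0 - x 3 = 0) ∧
      (k = g ∨ x 1 + x 4 = 0) ∧ (k = g⁻¹ ∨ x 2 + x 5 = 0) ∧
      (k = g * h ∨ x 1 - x 4 = 0) ∧ (k = g⁻¹ * h ∨ x 2 - x 5 = 0) := by
  constructor
  · intro hx
    have hadd : ∀ {p : Prop} {a b : F}, p ∨ a = 0 → p ∨ b = 0 → p ∨ a + b = 0 := by
      rintro p a b (hp | rfl) (hp' | rfl) <;> simp [*]
    have hmul : ∀ {p : Prop} {a b : F}, p ∨ b = 0 → p ∨ a * b = 0 := by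
      rintro p a b (hp | rfl) <;> simp [*]
    refine Submodule.span_induction (p := fun x _ =>
      (k = 1 ∨ x 0 + x 3 = 0) ∧ (k = h ∨ x 0 - x 3 = 0) ∧
      (k = g ∨ x 1 + x 4 = 0) ∧ (k = g⁻¹ ∨ x 2 + x 5 = 0) ∧
      (k = g * h ∨ x 1 - x 4 = 0) ∧ (k = g⁻¹ * h ∨ x 2 - x 5 = 0)) ?_ ?_ ?_ ?_ hx
    · rintro _ ⟨i, hi, rfl⟩
      have hk : _ = k := hi
      subst hk
      fin_cases i <;> simp [bv_apply]
    · simp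
    · rintro y z _ _ ⟨y0, y1, y2, y3, y4, y5⟩ ⟨z0, z1, z2, z3, z4, z5⟩
      simp only [add_apply, add_sub_add_comm, add_add_add_comm (y 0) (z 0),
        add_add_add_comm (y 1) (z 1), add_add_add_comm (y 2) (z 2)]
      exact ⟨hadd y0 z0, hadd y1 z1, hadd y2 z2, hadd y3 z3, hadd y4 z4, hadd y5 z5⟩
    · rintro c y _ ⟨y0, y1, y2, y3, y4, y5⟩
      simp only [smul_apply, smul_eq_mul, ← mul_add, ← mul_sub]
      exact ⟨hmul y0, hmul y1, hmul y2, hmul y3, hmul y4, hmul y5⟩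
  · rintro ⟨c0, c1, c2, c3, c4, c5⟩
    have hbasis : ∀ i : Fin 6,
        (![bv F 0 + bv F 3, bv F 0 - bv F 3, bv F 1 + bv F 4, bv F 2 + bv F 5,
          bv F 1 - bv F 4, bv F 2 - bv F 5] : Fin 6 → K33A F F) i ∈
        gamma2 F g h ((![1, h, g, g⁻¹, g * h, g⁻¹ * h] : Fin 6 → G) i) :=
      fun i => Submodule.subset_span ⟨i, rfl, rfl⟩
    have hsmul : ∀ {w : K33A F F} {d : G} {c : F}, w ∈ gamma2 F g h d → (k = d ∨ c = 0) →
        (2⁻¹ * c) • w ∈ gamma2 F g h k := by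
      rintro w d c hw (rfl | rfl)
      · exact Submodule.smul_mem _ _ hw
      · simp
    have hsum := add_mem (add_mem (add_mem (add_mem (add_mem (hsmul (hbasis 0) c0)
      (hsmul (hbasis 1) c1)) (hsmul (hbasis 2) c2)) (hsmul (hbasis 3) c3))
      (hsmul (hbasis 4) c4)) (hsmul (hbasis 5) c5)
    convert hsum using 1
    apply ext_coord <;> simp [bv_apply] <;> field_simp <;> ring

/-- The automorphism given by a multiplicative, parity preserving linear map with inverse. -/
def autOf (f f' : K33A F F →ₗ[F] K33A F F) (h₁ : ∀ x, f' (f x) = x) (h₂ : ∀ x, f (f' x) = x)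
    (hmul : ∀ x y, f (x * y) = f x * f y)
    (hev : ∀ x, f' x ∈ even F F F ↔ x ∈ even F F F)
    (hod : ∀ x, f' x ∈ odd F F F ↔ x ∈ odd F F F) :
    SuperAut F (K33A F F) (even F F F) (odd F F F) where
  e := LinearEquiv.ofLinearMap f f' (LinearMap.ext h₂) (LinearMap.ext h₁)
  map_mul' := hmul
  map_even := by
    ext x
    exact (Submodule.mem_map_equiv _).trans (hev x)
  map_odd := by
    ext x
    exact (Submodule.mem_map_equiv _).trans (hod x)

lemma gradIso_of_maps {ι : Type} {Γ Δ : ι → Submodule F (K33A F F)}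
    (f f' : K33A F F →ₗ[F] K33A F F) (h₁ : ∀ x, f' (f x) = x) (h₂ : ∀ x, f (f' x) = x)
    (hmul : ∀ x y, f (x * y) = f x * f y)
    (hev : ∀ x, f' x ∈ even F F F ↔ x ∈ even F F F)
    (hod : ∀ x, f' x ∈ odd F F F ↔ x ∈ odd F F F)
    (hΓ : ∀ k x, f' x ∈ Γ k ↔ x ∈ Δ k) :
    GradIso (even F F F) (odd F F F) Γ Δ :=
  ⟨autOf f f' h₁ h₂ hmul hev hod, fun k => by
    ext x
    exact (Submodule.mem_map_equiv _).trans (hΓ k x)⟩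

/-- The map fixing the first factor and acting as the parity automorphism on the second. -/
def paritySnd : K33A F F →ₗ[F] K33A F F where
  toFun x := ofCoord (x 0) (x 1) (x 2) (x 3) (-x 4) (-x 5)
  map_add' x y := by apply ext_coord <;> simp <;> ring
  map_smul' c x := by apply ext_coord <;> simp

lemma paritySnd_apply (x : K33A F F) :
    paritySnd x = ofCoord (x 0) (x 1) (x 2) (x 3) (-x 4) (-x 5) := rfl

/-- The map `u ↦ v`, `v ↦ -u` on both factors, fixing the even part. -/
def rotate : K33A F F →ₗ[F] K33A F F where
  toFun x := ofCoord (x 0) (-x 2) (x 1) (x 3) (-x 5) (x 4)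
  map_add' x y := by apply ext_coord <;> simp <;> ring
  map_smul' c x := by apply ext_coord <;> simp

/-- The inverse of `rotate`. -/
def rotateInv : K33A F F →ₗ[F] K33A F F where
  toFun x := ofCoord (x 0) (x 2) (-x 1) (x 3) (x 5) (-x 4)
  map_add' x y := by apply ext_coord <;> simp <;> ring
  map_smul' c x := by apply ext_coord <;> simp

lemma rotate_apply (x : K33A F F) : rotate x = ofCoord (x 0) (-x 2) (x 1) (x 3) (-x 5) (x 4) := rfl

lemma rotateInv_apply (x : K33A F F) :
    rotateInv x = ofCoord (x 0) (x 2) (-x 1) (x 3) (x 5) (-x 4) := rfl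

lemma gradIso_gamma2_mul (hchar : (2 : F) ≠ 0) {g h : G} (hh : h * h = 1) :
    GradIso (even F F F) (odd F F F) (gamma2 F g h) (gamma2 F (g * h) h) := by
  have hinv : h⁻¹ = h := inv_eq_of_mul_eq_one_left hh
  refine gradIso_of_maps paritySnd paritySnd ?_ ?_ ?_ ?_ ?_ ?_
  · intro x; apply ext_coord <;> simp [paritySnd_apply]
  · intro x; apply ext_coord <;> simp [paritySnd_apply]
  · intro x y
    apply ext_coord <;> simp [paritySnd_apply, mul_def, mulFun] <;> ring
  · intro x; simp [mem_even_iff, paritySnd_apply]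
  · intro x; simp [mem_odd_iff, paritySnd_apply]
  · intro k x
    simp only [mem_gamma2_iff hchar, paritySnd_apply, mul_inv, hinv, mul_assoc, hh, mul_one]
    simp only [ofCoord_zero, ofCoord_one, ofCoord_two, ofCoord_three, ofCoord_four,
      ofCoord_five, ← sub_eq_add_neg, sub_neg_eq_add]
    constructor <;> exact fun ⟨c0, c1, c2, c3, c4, c5⟩ => ⟨c0, c1, c4, c5, c2, c3⟩

lemma gradIso_gamma2_inv (hchar : (2 : F) ≠ 0) (g h : G) :
    GradIso (even F F F) (odd F F F) (gamma2 F g h) (gamma2 F g⁻¹ h) := by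
  refine gradIso_of_maps rotate rotateInv ?_ ?_ ?_ ?_ ?_ ?_
  · intro x; apply ext_coord <;> simp [rotate_apply, rotateInv_apply]
  · intro x; apply ext_coord <;> simp [rotate_apply, rotateInv_apply]
  · intro x y
    apply ext_coord <;> simp [rotate_apply, mul_def, mulFun] <;> ring
  · intro x; simp [mem_even_iff, rotateInv_apply]; tauto
  · intro x; simp [mem_odd_iff, rotateInv_apply]
  · intro k x
    have hadd : -x 1 + -x 4 = 0 ↔ x 1 + x 4 = 0 := by grind
    have hsub : -x 1 - -x 4 = 0 ↔ x 1 - x 4 = 0 := by grind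
    simp only [mem_gamma2_iff hchar, rotateInv_apply, inv_inv]
    simp only [ofCoord_zero, ofCoord_one, ofCoord_two, ofCoord_three, ofCoord_four,
      ofCoord_five, hadd, hsub]
    constructor <;> exact fun ⟨c0, c1, c2, c3, c4, c5⟩ => ⟨c0, c1, c3, c2, c5, c4⟩

lemma eq_or_eq_of_mem_gamma2_even (hchar : (2 : F) ≠ 0) {g h k : G} {x : K33A F F}
    (hx : x ∈ gamma2 F g h k) (hev : x ∈ even F F F) (h0 : x ≠ 0) : k = 1 ∨ k = h := by
  rw [mem_gamma2_iff hchar] at hx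
  rw [mem_even_iff] at hev
  obtain ⟨e1, e2, e4, e5⟩ := hev
  by_contra! hk
  have hadd := hx.1.resolve_left hk.1
  have hsub := hx.2.1.resolve_left hk.2
  refine h0 (ext_coord ?_ e1 e2 ?_ e4 e5) <;> simp only [zero_apply] <;> grind

lemma eq_of_mem_gamma2_odd (hchar : (2 : F) ≠ 0) {g h k : G} {x : K33A F F}
    (hx : x ∈ gamma2 F g h k) (hod : x ∈ odd F F F) (h0 : x ≠ 0) :
    k = g ∨ k = g⁻¹ ∨ k = g * h ∨ k = g⁻¹ * h := by
  rw [mem_gamma2_iff hchar] at hx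
  rw [mem_odd_iff] at hod
  obtain ⟨e0, e3⟩ := hod
  obtain ⟨-, -, c2, c3, c4, c5⟩ := hx
  by_contra! hk
  have h2 := c2.resolve_left hk.1
  have h3 := c3.resolve_left hk.2.1
  have h4 := c4.resolve_left hk.2.2.1
  have h5 := c5.resolve_left hk.2.2.2
  refine h0 (ext_coord e0 ?_ ?_ e3 ?_ ?_) <;> simp only [zero_apply] <;> grind

end K33A

end Gamma2Iso

end Kac

/-! ### STATEMENT 14 -/

open Kac in
/-- For `h, h'` of order two, `Γ²(G; g, h) ≅ Γ²(G; g', h')` on `K₃ × K₃` iff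
`h' = h` and `g' ∈ {g, gh, g⁻¹, g⁻¹h}`. -/
theorem gamma2_iso_iff (F : Type) [Field F] (hchar : (2 : F) ≠ 0)
    (G : Type) [CommGroup G] (g h g' h' : G)
    (hh : h * h = 1) (hne : h ≠ 1) (hh' : h' * h' = 1) (hne' : h' ≠ 1) :
    GradIso (K33A.even F F F) (K33A.odd F F F)
        (K33A.gamma2 F g h) (K33A.gamma2 F g' h') ↔
      (h' = h ∧ g' ∈ ({g, g * h, g⁻¹, g⁻¹ * h} : Set G)) := by
  constructor
  · rintro ⟨φ, hφ⟩
    have hmem : ∀ {k x}, x ∈ K33A.gamma2 F g h k → φ.e x ∈ K33A.gamma2 F g' h' k :=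
      fun hx => hφ _ ▸ Submodule.mem_map_of_mem hx
    have hhe : h' = h := by
      have hx : K33A.bv F 0 - K33A.bv F 3 ∈ K33A.gamma2 F g h h :=
        (K33A.mem_gamma2_iff hchar).2 (by simp [K33A.bv_apply])
      have hev : K33A.bv F 0 - K33A.bv F 3 ∈ K33A.even F F F :=
        K33A.mem_even_iff.2 (by simp [K33A.bv_apply])
      have h0 : K33A.bv F 0 - K33A.bv F 3 ≠ 0 := fun h0 => by
        simpa [K33A.bv_apply] using congrFun h0 0
      have hev' : φ.e (K33A.bv F 0 - K33A.bv F 3) ∈ K33A.even F F F :=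
        φ.map_even.le (Submodule.mem_map_of_mem hev)
      exact ((K33A.eq_or_eq_of_mem_gamma2_even hchar (hmem hx) hev'
        (φ.e.map_ne_zero_iff.2 h0)).resolve_left hne).symm
    subst hhe
    refine ⟨rfl, ?_⟩
    have hx : K33A.bv F 1 + K33A.bv F 4 ∈ K33A.gamma2 F g h' g :=
      (K33A.mem_gamma2_iff hchar).2 (by simp [K33A.bv_apply])
    have hod : K33A.bv F 1 + K33A.bv F 4 ∈ K33A.odd F F F :=
      K33A.mem_odd_iff.2 (by simp [K33A.bv_apply])
    have h0 : K33A.bv F 1 + K33A.bv F 4 ≠ 0 := fun h0 => by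
      simpa [K33A.bv_apply] using congrFun h0 1
    have hod' : φ.e (K33A.bv F 1 + K33A.bv F 4) ∈ K33A.odd F F F :=
      φ.map_odd.le (Submodule.mem_map_of_mem hod)
    have hinv : h'⁻¹ = h' := inv_eq_of_mul_eq_one_left hh
    rcases K33A.eq_of_mem_gamma2_odd hchar (hmem hx) hod' (φ.e.map_ne_zero_iff.2 h0) with
      rfl | rfl | rfl | rfl <;> simp [mul_assoc, mul_left_comm, hh, hinv]
  · rintro ⟨rfl, rfl | rfl | rfl | rfl⟩
    · exact GradIso.refl _ _ _
    · exact K33A.gradIso_gamma2_mul hchar hh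
    · exact K33A.gradIso_gamma2_inv hchar g h'
    · exact (K33A.gradIso_gamma2_inv hchar g h').trans (K33A.gradIso_gamma2_mul hchar hh)
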